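/- arXiv:1604.07979 — 5 statements merged into one kernel-verified Lean document; each statement's English description precedes it below -/
import Mathlib

section
/- Let X and Y be vector spaces over a field K, and let S and T be linear relations from X to Y. Then S = (S − T) + T if and only if D(S) ⊆ D(T) and T(0) ⊆ S(0). -/
open Set Filter Topology

namespace LinRel

variable {X Y : Type*}

/-- The domain `D(A) = {x : exists y, (x,y) in A}` of a linear relation. -/
def dom (A : Set (X × Y)) : Set X := {x | ∃ y, (x, y) ∈ A}

/-- The range `R(A) = {y : exists x, (x,y) in A}` of a linear relation. -/
def ran (A : Set (X × Y)) : Set Y := {y | ∃ x, (x, y) ∈ A}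

/-- The image `A(x) = {y : (x,y) in A}` of a point under a linear relation. -/
def im (A : Set (X × Y)) (x : X) : Set Y := {y | (x, y) ∈ A}

/-- The multivalued part `A(0) = {y : (0,y) in A}` of a linear relation. -/
def mulVal [Zero X] (A : Set (X × Y)) : Set Y := {y | ((0 : X), y) ∈ A}

/-- The null space `N(A) = {x : (x,0) in A}` of a linear relation. -/
def nullSp [Zero Y] (A : Set (X × Y)) : Set X := {x | (x, (0 : Y)) ∈ A}

/-- The norm `‖A(x)‖` of a linear relation at a point, defined as `d(A(x), A(0))`;
for a linear relation it equals `dist(y, A(0))` for any (equivalently, every) `y ∈ A(x)`. -/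
noncomputable def normAt [Zero X] [SeminormedAddCommGroup Y] (A : Set (X × Y)) (x : X) : ℝ :=
  sInf (Set.image2 (fun y z => ‖y - z‖) (im A x) (mulVal A))

/-- The set `{‖A(x)‖ : x ∈ D(A), ‖x‖ ≤ 1}`. -/
noncomputable def normSet [SeminormedAddCommGroup X] [SeminormedAddCommGroup Y]
    (A : Set (X × Y)) : Set ℝ :=
  normAt A '' {x ∈ dom A | ‖x‖ ≤ 1}

/-- The norm of a linear relation: `‖A‖ = sup {‖A(x)‖ : x ∈ D(A), ‖x‖ ≤ 1}`. -/
noncomputable def rnorm [SeminormedAddCommGroup X] [SeminormedAddCommGroup Y]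
    (A : Set (X × Y)) : ℝ :=
  sSup (normSet A)

/-- A linear relation is bounded if its norm is finite, i.e. the set
`{‖A(x)‖ : x ∈ D(A), ‖x‖ ≤ 1}` is bounded above. -/
def IsBdd [SeminormedAddCommGroup X] [SeminormedAddCommGroup Y] (A : Set (X × Y)) : Prop :=
  BddAbove (normSet A)

/-- A relation is closable if its closure has the same images at all points of its domain. -/
def IsClosableRel [TopologicalSpace X] [TopologicalSpace Y] (A : Set (X × Y)) : Prop :=
  ∀ x ∈ dom A, im (closure A) x = im A x

section ops

variable {K₀ X₀ Y₀ : Type*} [Field K₀] [AddCommGroup X₀] [Module K₀ X₀]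
  [AddCommGroup Y₀] [Module K₀ Y₀]

/-- The sum of two linear relations: `T + S := {(x, y + z) : (x,y) ∈ T, (x,z) ∈ S}`. -/
def radd (T S : Submodule K₀ (X₀ × Y₀)) : Submodule K₀ (X₀ × Y₀) where
  carrier := {p | ∃ y z, (p.1, y) ∈ T ∧ (p.1, z) ∈ S ∧ p.2 = y + z}
  add_mem' := by
    rintro ⟨a, b⟩ ⟨c, d⟩ ⟨y1, z1, h1, h2, rfl⟩ ⟨y2, z2, h3, h4, rfl⟩
    exact ⟨y1 + y2, z1 + z2, T.add_mem h1 h3, S.add_mem h2 h4,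
      add_add_add_comm y1 z1 y2 z2⟩
  zero_mem' := ⟨0, 0, T.zero_mem, S.zero_mem, (add_zero 0).symm⟩
  smul_mem' := by
    rintro c ⟨a, b⟩ ⟨y, z, h1, h2, rfl⟩
    exact ⟨c • y, c • z, T.smul_mem c h1, S.smul_mem c h2, smul_add c y z⟩

/-- The scalar multiple of a linear relation: `α T := {(x, α y) : (x, y) ∈ T}`. -/
def rsmul (α : K₀) (T : Submodule K₀ (X₀ × Y₀)) : Submodule K₀ (X₀ × Y₀) :=
  T.map ((LinearMap.id : X₀ →ₗ[K₀] X₀).prodMap (α • (LinearMap.id : Y₀ →ₗ[K₀] Y₀)))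

/-- The difference of two linear relations: `S - T := S + (-1) T`. -/
def rsub (S T : Submodule K₀ (X₀ × Y₀)) : Submodule K₀ (X₀ × Y₀) :=
  radd S (rsmul (-1 : K₀) T)

/-- `T(0)` as a submodule of `Y₀`. -/
def mulSub (T : Submodule K₀ (X₀ × Y₀)) : Submodule K₀ Y₀ :=
  T.comap (LinearMap.inr K₀ X₀ Y₀)

end ops

end LinRel

open LinRel

namespace LinRel

variable {K X Y : Type*} [Field K] [AddCommGroup X] [Module K X] [AddCommGroup Y] [Module K Y]

theorem mk_mem_radd {S T : Submodule K (X × Y)} {x : X} {w : Y} :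
    (x, w) ∈ radd S T ↔ ∃ y z, (x, y) ∈ S ∧ (x, z) ∈ T ∧ w = y + z :=
  Iff.rfl

theorem mk_mem_rsub {S T : Submodule K (X × Y)} {x : X} {w : Y} :
    (x, w) ∈ rsub S T ↔ ∃ y z, (x, y) ∈ S ∧ (x, z) ∈ T ∧ w = y - z := by
  simp only [rsub, rsmul, mk_mem_radd, Submodule.mem_map]
  constructor
  · rintro ⟨y, _, hy, ⟨⟨a, z⟩, hz, h⟩, rfl⟩
    obtain ⟨rfl, rfl⟩ : a = x ∧ -z = _ := by simpa using h
    exact ⟨y, z, hy, hz, (sub_eq_add_neg y z).symm⟩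
  · rintro ⟨y, z, hy, hz, rfl⟩
    exact ⟨y, -z, hy, ⟨(x, z), hz, by simp⟩, sub_eq_add_neg y z⟩

end LinRel

/-- Let `X` and `Y` be vector spaces over a field `K`, and let `S` and `T`
be linear relations from `X` to `Y`. Then `S = (S - T) + T` if and only if
`D(S) ⊆ D(T)` and `T(0) ⊆ S(0)`. -/
theorem statement0 {K X Y : Type*} [Field K] [AddCommGroup X] [Module K X]
    [AddCommGroup Y] [Module K Y] (S T : Submodule K (X × Y)) :
    S = radd (rsub S T) T ↔
      dom (S : Set (X × Y)) ⊆ dom (T : Set (X × Y)) ∧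
        mulVal (T : Set (X × Y)) ⊆ mulVal (S : Set (X × Y)) := by
  constructor
  · intro h
    constructor
    · rintro x ⟨y, hy⟩
      rw [SetLike.mem_coe, h] at hy
      obtain ⟨_, z, -, hz, -⟩ := mk_mem_radd.1 hy
      exact ⟨z, hz⟩
    · intro y hy
      change (0, y) ∈ S
      rw [h]
      exact mk_mem_radd.2
        ⟨0, y, mk_mem_rsub.2 ⟨0, 0, S.zero_mem, T.zero_mem, (sub_zero 0).symm⟩, hy,
          (zero_add y).symm⟩
  · rintro ⟨hdom, hmul⟩
    ext ⟨x, w⟩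
    rw [mk_mem_radd]
    constructor
    · intro hw
      obtain ⟨z, hz⟩ := hdom ⟨w, hw⟩
      exact ⟨w - z, z, mk_mem_rsub.2 ⟨w, z, hw, hz, rfl⟩, hz, (sub_add_cancel w z).symm⟩
    · rintro ⟨_, z', hsub, hz', rfl⟩
      obtain ⟨y, z, hy, hz, rfl⟩ := mk_mem_rsub.1 hsub
      have hdiff : (0, z' - z) ∈ S := hmul (by simpa [mulVal] using T.sub_mem hz' hz)
      have hsum := S.add_mem hy hdiff
      rw [Prod.mk_add_mk, add_zero] at hsum
      rwa [sub_add_eq_add_sub, add_sub_assoc]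
end

section
/- Let X and Y be normed spaces and let S, T be linear relations from X to Y with D(S) ⊆ D(T) and cl(T(0)) ⊆ cl(S(0)). Then ‖(S − T)(x)‖ ≥ ‖S(x)‖ − ‖T(x)‖ for every x ∈ D(S). Further, if S and T are bounded, then S − T is bounded and ‖S − T‖ ≥ ‖S‖ − ‖T‖. In addition, if either T is bounded and S is unbounded, or S is bounded, the restriction of T to D(S) is unbounded and cl(T(0)) = cl(S(0)), then S − T is unbounded. -/
open Set Filter Topology

namespace LinRel

section Norm

variable {K X Y : Type*} [NontriviallyNormedField K]
  [NormedAddCommGroup X] [NormedSpace K X] [NormedAddCommGroup Y] [NormedSpace K Y]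

theorem normAt_le {A : Submodule K (X × Y)} {x : X} {y : Y} (h : (x, y) ∈ A) :
    normAt (A : Set (X × Y)) x ≤ ‖y‖ := by
  refine csInf_le ⟨0, ?_⟩ ⟨y, h, 0, A.zero_mem, by simp⟩
  rintro _ ⟨y, -, z, -, rfl⟩
  exact norm_nonneg _

theorem exists_norm_lt {A : Submodule K (X × Y)} {x : X} (hx : x ∈ dom (A : Set (X × Y)))
    {ε : ℝ} (hε : 0 < ε) :
    ∃ y, (x, y) ∈ A ∧ ‖y‖ < normAt (A : Set (X × Y)) x + ε := by
  obtain ⟨y₀, hy₀⟩ := hx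
  have hne : (Set.image2 (fun y z => ‖y - z‖) (im (A : Set (X × Y)) x)
      (mulVal (A : Set (X × Y)))).Nonempty := ⟨_, y₀, hy₀, 0, A.zero_mem, rfl⟩
  obtain ⟨_, ⟨y, hy, z, hz, rfl⟩, hlt⟩ := Real.lt_sInf_add_pos hne hε
  exact ⟨y - z, by simpa using A.sub_mem hy hz, hlt⟩

theorem mem_rsub {S T : Submodule K (X × Y)} {x : X} {w : Y} :
    (x, w) ∈ rsub S T ↔ ∃ y t, (x, y) ∈ S ∧ (x, t) ∈ T ∧ w = y - t := by
  constructor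
  · rintro ⟨y, z, hy, ⟨⟨a, t⟩, ht, hz⟩, rfl⟩
    simp only [LinearMap.prodMap_apply, LinearMap.id_apply, neg_smul,
      one_smul, Prod.mk.injEq] at hz
    obtain ⟨rfl, rfl⟩ := hz
    exact ⟨y, t, hy, ht, (sub_eq_add_neg y t).symm⟩
  · rintro ⟨y, t, hy, ht, rfl⟩
    exact ⟨y, -t, hy, ⟨(x, t), ht, by simp⟩, sub_eq_add_neg y t⟩

theorem mem_dom_rsub {S T : Submodule K (X × Y)} {x : X} :
    x ∈ dom (rsub S T : Set (X × Y)) ↔ x ∈ dom (S : Set (X × Y)) ∧ x ∈ dom (T : Set (X × Y)) := by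
  constructor
  · rintro ⟨w, hw⟩
    obtain ⟨y, t, hy, ht, -⟩ := mem_rsub.1 hw
    exact ⟨⟨y, hy⟩, ⟨t, ht⟩⟩
  · rintro ⟨⟨y, hy⟩, ⟨t, ht⟩⟩
    exact ⟨y - t, mem_rsub.2 ⟨y, t, hy, ht, rfl⟩⟩

theorem normAt_le_norm_sub_add {S T : Submodule K (X × Y)}
    (hcl : closure (mulVal (T : Set (X × Y))) ⊆ closure (mulVal (S : Set (X × Y))))
    {x : X} {y t : Y} (hy : (x, y) ∈ S) (ht : (x, t) ∈ T) :
    normAt (S : Set (X × Y)) x ≤ ‖y - t‖ + normAt (T : Set (X × Y)) x := by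
  refine le_of_forall_pos_le_add fun ε hε => ?_
  obtain ⟨t', ht', hlt⟩ := exists_norm_lt (A := T) ⟨t, ht⟩ (half_pos hε)
  have hdiff : t - t' ∈ mulVal (T : Set (X × Y)) := by
    simpa [mulVal] using T.sub_mem ht ht'
  obtain ⟨s, hs, hdist⟩ := Metric.mem_closure_iff.1 (hcl (subset_closure hdiff)) _ (half_pos hε)
  rw [dist_eq_norm] at hdist
  have hmem : (x, y - s) ∈ S := by simpa using S.sub_mem hy hs
  calc normAt (S : Set (X × Y)) x ≤ ‖y - s‖ := normAt_le hmem
    _ = ‖(y - t) + (t - t' - s) + t'‖ := by congr 1; abel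
    _ ≤ ‖y - t‖ + ‖t - t' - s‖ + ‖t'‖ := norm_add₃_le
    _ ≤ ‖y - t‖ + normAt (T : Set (X × Y)) x + ε := by linarith

theorem normAt_le_normAt_rsub_add {S T : Submodule K (X × Y)}
    (hcl : closure (mulVal (T : Set (X × Y))) ⊆ closure (mulVal (S : Set (X × Y))))
    {x : X} (hS : x ∈ dom (S : Set (X × Y))) (hT : x ∈ dom (T : Set (X × Y))) :
    normAt (S : Set (X × Y)) x ≤
      normAt (rsub S T : Set (X × Y)) x + normAt (T : Set (X × Y)) x := by
  refine le_of_forall_pos_le_add fun ε hε => ?_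
  obtain ⟨w, hw, hlt⟩ := exists_norm_lt (mem_dom_rsub.2 ⟨hS, hT⟩) hε
  obtain ⟨y, t, hy, ht, rfl⟩ := mem_rsub.1 hw
  linarith [normAt_le_norm_sub_add hcl hy ht]

theorem normAt_le_normAt_rsub_add' {S T : Submodule K (X × Y)}
    (hcl : closure (mulVal (S : Set (X × Y))) ⊆ closure (mulVal (T : Set (X × Y))))
    {x : X} (hS : x ∈ dom (S : Set (X × Y))) (hT : x ∈ dom (T : Set (X × Y))) :
    normAt (T : Set (X × Y)) x ≤
      normAt (rsub S T : Set (X × Y)) x + normAt (S : Set (X × Y)) x := by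
  refine le_of_forall_pos_le_add fun ε hε => ?_
  obtain ⟨w, hw, hlt⟩ := exists_norm_lt (mem_dom_rsub.2 ⟨hS, hT⟩) hε
  obtain ⟨y, t, hy, ht, rfl⟩ := mem_rsub.1 hw
  rw [norm_sub_rev] at hlt
  linarith [normAt_le_norm_sub_add hcl ht hy]

theorem normAt_rsub_le {S T : Submodule K (X × Y)}
    {x : X} (hS : x ∈ dom (S : Set (X × Y))) (hT : x ∈ dom (T : Set (X × Y))) :
    normAt (rsub S T : Set (X × Y)) x ≤
      normAt (S : Set (X × Y)) x + normAt (T : Set (X × Y)) x := by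
  refine le_of_forall_pos_le_add fun ε hε => ?_
  obtain ⟨y, hy, hlty⟩ := exists_norm_lt hS (half_pos hε)
  obtain ⟨t, ht, hltt⟩ := exists_norm_lt hT (half_pos hε)
  linarith [normAt_le (mem_rsub.2 ⟨y, t, hy, ht, rfl⟩), norm_sub_le y t]

theorem normAt_le_rnorm {A : Set (X × Y)} (hA : IsBdd A) {x : X} (hx : x ∈ dom A)
    (h1 : ‖x‖ ≤ 1) : normAt A x ≤ rnorm A :=
  le_csSup hA ⟨x, ⟨hx, h1⟩, rfl⟩

theorem isBdd_of_normAt_le {A : Set (X × Y)} (c : ℝ)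
    (h : ∀ x ∈ dom A, ‖x‖ ≤ 1 → normAt A x ≤ c) : IsBdd A :=
  ⟨c, by rintro _ ⟨x, ⟨hx, h1⟩, rfl⟩; exact h x hx h1⟩

theorem rnorm_le {A : Submodule K (X × Y)} {c : ℝ}
    (h : ∀ x ∈ dom (A : Set (X × Y)), ‖x‖ ≤ 1 → normAt (A : Set (X × Y)) x ≤ c) :
    rnorm (A : Set (X × Y)) ≤ c := by
  refine csSup_le ⟨_, 0, ⟨⟨0, A.zero_mem⟩, by simp⟩, rfl⟩ ?_
  rintro _ ⟨x, ⟨hx, h1⟩, rfl⟩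
  exact h x hx h1

theorem mem_restrict_dom {S T : Submodule K (X × Y)} {x : X} {y : Y} :
    (x, y) ∈ T ⊓ Submodule.comap (LinearMap.fst K X Y) (S.map (LinearMap.fst K X Y)) ↔
      (x, y) ∈ T ∧ x ∈ dom (S : Set (X × Y)) := by
  simp [dom]

theorem normAt_restrict_dom_le {S T : Submodule K (X × Y)} {x : X}
    (hS : x ∈ dom (S : Set (X × Y))) (hT : x ∈ dom (T : Set (X × Y))) :
    normAt ((T ⊓ Submodule.comap (LinearMap.fst K X Y)
      (S.map (LinearMap.fst K X Y)) : Submodule K (X × Y)) : Set (X × Y)) x ≤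
      normAt (T : Set (X × Y)) x := by
  refine le_of_forall_pos_le_add fun ε hε => ?_
  obtain ⟨t, ht, hlt⟩ := exists_norm_lt hT hε
  exact (normAt_le (mem_restrict_dom.2 ⟨ht, hS⟩)).trans hlt.le

theorem IsBdd.rsub {S T : Submodule K (X × Y)} (hS : IsBdd (S : Set (X × Y)))
    (hT : IsBdd (T : Set (X × Y))) : IsBdd (rsub S T : Set (X × Y)) := by
  refine isBdd_of_normAt_le (rnorm (S : Set (X × Y)) + rnorm (T : Set (X × Y)))
    fun x hx h1 => ?_
  obtain ⟨hxS, hxT⟩ := mem_dom_rsub.1 hx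
  linarith [normAt_rsub_le hxS hxT, normAt_le_rnorm hS hxS h1, normAt_le_rnorm hT hxT h1]

end Norm

end LinRel

open LinRel

/-- Let `X` and `Y` be normed spaces and `S`, `T` linear relations from `X`
to `Y` with `D(S) ⊆ D(T)` and `cl(T(0)) ⊆ cl(S(0))`. Then
`‖(S - T)(x)‖ ≥ ‖S(x)‖ - ‖T(x)‖` for every `x ∈ D(S)`. Further, if `S` and `T` are bounded,
then `S - T` is bounded and `‖S - T‖ ≥ ‖S‖ - ‖T‖`. In addition, if either `T` is bounded
and `S` is unbounded, or `S` is bounded, `T` restricted to `D(S)` is unbounded and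
`cl(T(0)) = cl(S(0))`, then `S - T` is unbounded. -/
theorem statement1 {K X Y : Type*} [NontriviallyNormedField K]
    [NormedAddCommGroup X] [NormedSpace K X] [NormedAddCommGroup Y] [NormedSpace K Y]
    (S T : Submodule K (X × Y))
    (hdom : dom (S : Set (X × Y)) ⊆ dom (T : Set (X × Y)))
    (hcl : closure (mulVal (T : Set (X × Y))) ⊆ closure (mulVal (S : Set (X × Y)))) :
    (∀ x ∈ dom (S : Set (X × Y)),
        normAt (S : Set (X × Y)) x - normAt (T : Set (X × Y)) x ≤
          normAt (rsub S T : Set (X × Y)) x) ∧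
    (IsBdd (S : Set (X × Y)) → IsBdd (T : Set (X × Y)) →
        IsBdd (rsub S T : Set (X × Y)) ∧
          rnorm (S : Set (X × Y)) - rnorm (T : Set (X × Y)) ≤ rnorm (rsub S T : Set (X × Y))) ∧
    ((IsBdd (T : Set (X × Y)) ∧ ¬ IsBdd (S : Set (X × Y))) ∨
        (IsBdd (S : Set (X × Y)) ∧
          ¬ IsBdd ((T ⊓ Submodule.comap (LinearMap.fst K X Y)
              (S.map (LinearMap.fst K X Y)) : Submodule K (X × Y)) : Set (X × Y)) ∧
          closure (mulVal (T : Set (X × Y))) = closure (mulVal (S : Set (X × Y)))) →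
      ¬ IsBdd (rsub S T : Set (X × Y))) := by
  refine ⟨fun x hx => ?_, fun hS hT => ⟨hS.rsub hT, ?_⟩, ?_⟩
  · linarith [normAt_le_normAt_rsub_add hcl hx (hdom hx)]
  · rw [sub_le_iff_le_add]
    refine rnorm_le fun x hx h1 => ?_
    linarith [normAt_le_normAt_rsub_add hcl hx (hdom hx), normAt_le_rnorm hT (hdom hx) h1,
      normAt_le_rnorm (hS.rsub hT) (mem_dom_rsub.2 ⟨hx, hdom hx⟩) h1]
  · rintro (⟨hT, hS⟩ | ⟨hS, hT, heq⟩) hST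
    · refine hS (isBdd_of_normAt_le (rnorm (rsub S T : Set (X × Y)) + rnorm (T : Set (X × Y)))
        fun x hx h1 => ?_)
      linarith [normAt_le_normAt_rsub_add hcl hx (hdom hx), normAt_le_rnorm hT (hdom hx) h1,
        normAt_le_rnorm hST (mem_dom_rsub.2 ⟨hx, hdom hx⟩) h1]
    · refine hT (isBdd_of_normAt_le (rnorm (rsub S T : Set (X × Y)) + rnorm (S : Set (X × Y)))
        fun x ⟨_, hy⟩ h1 => ?_)
      have hx := (mem_restrict_dom.1 hy).2
      linarith [normAt_restrict_dom_le hx (hdom hx),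
        normAt_le_normAt_rsub_add' heq.ge hx (hdom hx), normAt_le_rnorm hS hx h1,
        normAt_le_rnorm hST (mem_dom_rsub.2 ⟨hx, hdom hx⟩) h1]
end

section
/- (Closed graph theorem for linear relations.) Let X and Y be Banach spaces and T a linear relation from X to Y. Then the following statements are equivalent: (i) T and D(T) are closed; (ii) T is bounded, and D(T) and T(0) are closed; (iii) T is bounded and closed. -/
open Set Filter Topology

open LinRel

namespace LinRel

section Selection

variable {K X Y : Type*} [NontriviallyNormedField K] [NormedAddCommGroup X] [NormedSpace K X]
  [NormedAddCommGroup Y] [NormedSpace K Y] (T : Submodule K (X × Y))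

/-- The domain of a linear relation as a submodule. -/
def domSubmodule : Submodule K X := T.map (LinearMap.fst K X Y)

theorem coe_domSubmodule : (domSubmodule T : Set X) = dom (T : Set (X × Y)) := by
  ext x
  simp [domSubmodule, dom]

/-- A linear relation is bounded iff it has selections whose norm is controlled linearly. -/
theorem isBdd_iff_exists_selection :
    IsBdd (T : Set (X × Y)) ↔
      ∃ C : ℝ, 0 < C ∧ ∀ x ∈ dom (T : Set (X × Y)), ∃ w, (x, w) ∈ T ∧ ‖w‖ ≤ C * ‖x‖ := by
  constructor
  · rintro ⟨M, hM⟩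
    obtain ⟨c, hc⟩ := NormedField.exists_one_lt_norm K
    refine ⟨‖c‖ * (|M| + 1), by positivity, ?_⟩
    rintro x ⟨y, hy⟩
    rcases eq_or_ne x 0 with rfl | hx
    · exact ⟨0, T.zero_mem, by simp⟩
    obtain ⟨d, hd, hdx, -, hdinv⟩ := rescale_to_shell hc one_pos hx
    have hdy : (d • x, d • y) ∈ T := T.smul_mem d hy
    have hle : normAt (T : Set (X × Y)) (d • x) ≤ M :=
      hM ⟨d • x, ⟨⟨d • y, hdy⟩, hdx.le⟩, rfl⟩
    have hlt : normAt (T : Set (X × Y)) (d • x) < |M| + 1 := by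
      linarith [le_abs_self M]
    have hne : (Set.image2 (fun y z => ‖y - z‖) (im (T : Set (X × Y)) (d • x))
        (mulVal (T : Set (X × Y)))).Nonempty :=
      ⟨_, d • y, hdy, 0, T.zero_mem, rfl⟩
    obtain ⟨_, ⟨y', hy', z, hz, rfl⟩, hlt⟩ := exists_lt_of_csInf_lt hne hlt
    refine ⟨d⁻¹ • (y' - z), ?_, ?_⟩
    · have h := T.smul_mem d⁻¹ (T.sub_mem hy' hz)
      simpa [inv_smul_smul₀ hd] using h
    · rw [norm_smul, norm_inv]
      calc ‖d‖⁻¹ * ‖y' - z‖ ≤ (‖c‖ * ‖x‖) * (|M| + 1) := by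
            have : ‖d‖⁻¹ ≤ ‖c‖ * ‖x‖ := by simpa using hdinv
            have h' : ‖y' - z‖ ≤ |M| + 1 := hlt.le
            gcongr
        _ = ‖c‖ * (|M| + 1) * ‖x‖ := by ring
  · rintro ⟨C, hC, h⟩
    refine ⟨C, ?_⟩
    rintro _ ⟨x, ⟨hx, hx1⟩, rfl⟩
    obtain ⟨w, hw, hwn⟩ := h x hx
    have hbdd : BddBelow (Set.image2 (fun y z => ‖y - z‖) (im (T : Set (X × Y)) x)
        (mulVal (T : Set (X × Y)))) := by
      refine ⟨0, ?_⟩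
      rintro _ ⟨y, -, z, -, rfl⟩
      exact norm_nonneg _
    calc normAt (T : Set (X × Y)) x ≤ ‖w - 0‖ := csInf_le hbdd ⟨w, hw, 0, T.zero_mem, rfl⟩
      _ ≤ C * ‖x‖ := by simpa using hwn
      _ ≤ C := by nlinarith

variable {T}

theorem isClosed_mulVal (hT : IsClosed (T : Set (X × Y))) :
    IsClosed (mulVal (T : Set (X × Y))) :=
  hT.preimage (f := fun y : Y => ((0 : X), y)) (by fun_prop)

/-- A closed linear relation between Banach spaces with closed domain is bounded. -/
theorem isBdd_of_isClosed [CompleteSpace X] [CompleteSpace Y]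
    (hT : IsClosed (T : Set (X × Y))) (hD : IsClosed (dom (T : Set (X × Y)))) :
    IsBdd (T : Set (X × Y)) := by
  rw [isBdd_iff_exists_selection]
  rw [← coe_domSubmodule] at hD
  have : CompleteSpace T := hT.completeSpace_coe
  have : CompleteSpace (domSubmodule T) := hD.completeSpace_coe
  let f : T →L[K] domSubmodule T :=
    ((ContinuousLinearMap.fst K X Y).comp T.subtypeL).codRestrict (domSubmodule T)
      fun p => ⟨p, p.2, rfl⟩
  have hf : Function.Surjective f := by
    rintro ⟨_, p, hp, rfl⟩
    exact ⟨⟨p, hp⟩, rfl⟩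
  obtain ⟨C, hC, h⟩ := f.exists_preimage_norm_le hf
  refine ⟨C, hC, fun x hx => ?_⟩
  rw [← coe_domSubmodule] at hx
  obtain ⟨⟨⟨a, w⟩, hp⟩, hpx, hpn⟩ := h ⟨x, hx⟩
  obtain rfl : a = x := congrArg Subtype.val hpx
  exact ⟨w, hp, (norm_snd_le (a, w)).trans hpn⟩

/-- A bounded linear relation with closed domain and closed multivalued part is closed. -/
theorem isClosed_of_isBdd (hB : IsBdd (T : Set (X × Y)))
    (hD : IsClosed (dom (T : Set (X × Y)))) (h0 : IsClosed (mulVal (T : Set (X × Y)))) :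
    IsClosed (T : Set (X × Y)) := by
  obtain ⟨C, hC, hsel⟩ := (isBdd_iff_exists_selection T).1 hB
  refine IsSeqClosed.isClosed ?_
  rintro p ⟨x, y⟩ hp hlim
  have hx : Tendsto (fun n => (p n).1) atTop (𝓝 x) := (continuous_fst.tendsto _).comp hlim
  have hy : Tendsto (fun n => (p n).2) atTop (𝓝 y) := (continuous_snd.tendsto _).comp hlim
  obtain ⟨y₀, hy₀⟩ : x ∈ dom (T : Set (X × Y)) :=
    hD.mem_of_tendsto hx (Eventually.of_forall fun n => ⟨(p n).2, hp n⟩)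
  have hsub (n : ℕ) : ((p n).1 - x, (p n).2 - y₀) ∈ T := T.sub_mem (hp n) hy₀
  choose w hw hwn using fun n => hsel ((p n).1 - x) ⟨_, hsub n⟩
  have hw0 : Tendsto w atTop (𝓝 0) := by
    refine squeeze_zero_norm hwn ?_
    have : Tendsto (fun n => C * ‖(p n).1 - x‖) atTop (𝓝 (C * ‖x - x‖)) :=
      ((hx.sub_const x).norm).const_mul C
    simpa using this
  have hmem : y - y₀ ∈ mulVal (T : Set (X × Y)) := by
    have hl : Tendsto (fun n => (p n).2 - y₀ - w n) atTop (𝓝 (y - y₀)) := by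
      simpa using (hy.sub_const y₀).sub hw0
    refine h0.mem_of_tendsto hl (Eventually.of_forall fun n => ?_)
    simpa [mulVal] using T.sub_mem (hsub n) (hw n)
  simpa using T.add_mem hmem hy₀

/-- A bounded closed linear relation between Banach spaces has closed domain. -/
theorem isClosed_dom [CompleteSpace X] [CompleteSpace Y] (hB : IsBdd (T : Set (X × Y)))
    (hT : IsClosed (T : Set (X × Y))) : IsClosed (dom (T : Set (X × Y))) := by
  obtain ⟨C, hC, hsel⟩ := (isBdd_iff_exists_selection T).1 hB
  have : CompleteSpace T := hT.completeSpace_coe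
  let f : NormedAddGroupHom T X :=
    ((LinearMap.fst K X Y).comp T.subtype).toAddMonoidHom.mkNormedAddGroupHom 1
      fun p => by simpa using norm_fst_le (p : X × Y)
  have hf : f.SurjectiveOnWith (domSubmodule T).toAddSubgroup (max 1 C) := by
    intro x hx
    have hx' : x ∈ dom (T : Set (X × Y)) := by
      rw [← coe_domSubmodule]
      exact hx
    obtain ⟨w, hw, hwn⟩ := hsel x hx'
    refine ⟨⟨(x, w), hw⟩, rfl, max_le (a := ‖x‖) (b := ‖w‖) ?_ ?_⟩
    · exact le_mul_of_one_le_left (norm_nonneg x) (le_max_left 1 C)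
    · exact hwn.trans (by gcongr; exact le_max_right 1 C)
  have hcl := controlled_closure_of_complete (lt_max_of_lt_left one_pos) one_pos hf
  refine isClosed_of_closure_subset fun x hx => ?_
  rw [← coe_domSubmodule] at hx
  obtain ⟨g, rfl, -⟩ := hcl x hx
  exact ⟨g.1.2, g.2⟩

end Selection

end LinRel

/-- **Closed graph theorem for linear relations.** Let `X` and `Y` be Banach
spaces and `T` a linear relation from `X` to `Y`. Then the following statements are
equivalent: (i) `T` and `D(T)` are closed; (ii) `T` is bounded, and `D(T)` and `T(0)` are
closed; (iii) `T` is bounded and closed. -/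
theorem statement16 {K X Y : Type*} [NontriviallyNormedField K]
    [NormedAddCommGroup X] [NormedSpace K X] [CompleteSpace X]
    [NormedAddCommGroup Y] [NormedSpace K Y] [CompleteSpace Y]
    (T : Submodule K (X × Y)) :
    (IsClosed (T : Set (X × Y)) ∧ IsClosed (dom (T : Set (X × Y))) ↔
      IsBdd (T : Set (X × Y)) ∧ IsClosed (dom (T : Set (X × Y))) ∧
        IsClosed (mulVal (T : Set (X × Y)))) ∧
    (IsBdd (T : Set (X × Y)) ∧ IsClosed (dom (T : Set (X × Y))) ∧
        IsClosed (mulVal (T : Set (X × Y))) ↔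
      IsBdd (T : Set (X × Y)) ∧ IsClosed (T : Set (X × Y))) := by
  refine ⟨⟨fun ⟨hT, hD⟩ => ⟨isBdd_of_isClosed hT hD, hD, isClosed_mulVal hT⟩,
    fun ⟨hB, hD, h0⟩ => ⟨isClosed_of_isBdd hB hD h0, hD⟩⟩,
    fun ⟨hB, hD, h0⟩ => ⟨hB, isClosed_of_isBdd hB hD h0⟩,
    fun ⟨hB, hT⟩ => ⟨hB, isClosed_dom hB hT, isClosed_mulVal hT⟩⟩
end

section
/- (Open mapping theorem for linear relations.) Let X and Y be Banach spaces and T a linear relation from X to Y whose range R(T) is closed. Then T is closed if and only if the inverse relation T⁻¹ is bounded and the null space N(T) is closed. -/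
open Set Filter Topology

namespace LinRel

theorem isBdd_swap_iff {K X Y : Type*} [NontriviallyNormedField K]
    [NormedAddCommGroup X] [NormedSpace K X] [NormedAddCommGroup Y] [NormedSpace K Y]
    (T : Submodule K (X × Y)) :
    IsBdd (Prod.swap ⁻¹' (T : Set (X × Y)) : Set (Y × X)) ↔
      ∃ C : ℝ, ∀ y ∈ ran (T : Set (X × Y)), ∃ x, (x, y) ∈ T ∧ ‖x‖ ≤ C * ‖y‖ := by
  constructor
  · rintro ⟨M, hM⟩
    obtain ⟨c, hc⟩ := NormedField.exists_one_lt_norm K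
    refine ⟨‖c‖ * (M + 1), ?_⟩
    rintro y ⟨x₀, hx₀⟩
    by_cases hy : y = 0
    · subst hy
      exact ⟨0, T.zero_mem, by simp⟩
    obtain ⟨d, hd, hdy, -, hd'⟩ := rescale_to_shell hc one_pos hy
    have hdT : (d • x₀, d • y) ∈ T := T.smul_mem d hx₀
    have hle : normAt (Prod.swap ⁻¹' (T : Set (X × Y))) (d • y) ≤ M :=
      hM ⟨d • y, ⟨⟨d • x₀, hdT⟩, hdy.le⟩, rfl⟩
    obtain ⟨-, ⟨x, hx, z, hz, rfl⟩, hlt⟩ := exists_lt_of_csInf_lt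
      (⟨_, d • x₀, hdT, 0, T.zero_mem, rfl⟩ : (Set.image2 (fun y z => ‖y - z‖)
        (im (Prod.swap ⁻¹' (T : Set (X × Y))) (d • y))
        (mulVal (Prod.swap ⁻¹' (T : Set (X × Y))))).Nonempty)
      (lt_of_le_of_lt hle (lt_add_one M))
    have hxz : (x - z, d • y) ∈ T := by
      have h := T.sub_mem (show (x, d • y) ∈ T from hx) (show (z, (0 : Y)) ∈ T from hz)
      simpa using h
    refine ⟨d⁻¹ • (x - z), ?_, ?_⟩
    · have h := T.smul_mem d⁻¹ hxz
      simpa [Prod.smul_mk, inv_smul_smul₀ hd] using h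
    · rw [norm_smul, norm_inv]
      calc ‖d‖⁻¹ * ‖x - z‖ ≤ (1⁻¹ * ‖c‖ * ‖y‖) * (M + 1) := by
            gcongr
        _ = ‖c‖ * (M + 1) * ‖y‖ := by ring
  · rintro ⟨C, hC⟩
    refine ⟨max C 0, ?_⟩
    rintro - ⟨y, ⟨hy, hy1⟩, rfl⟩
    obtain ⟨x, hx, hxC⟩ := hC y hy
    have hbdd : BddBelow (Set.image2 (fun y z => ‖y - z‖)
        (im (Prod.swap ⁻¹' (T : Set (X × Y))) y)
        (mulVal (Prod.swap ⁻¹' (T : Set (X × Y))))) := by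
      refine ⟨0, ?_⟩
      rintro - ⟨a, -, b, -, rfl⟩
      exact norm_nonneg _
    calc normAt (Prod.swap ⁻¹' (T : Set (X × Y))) y ≤ ‖x - 0‖ :=
          csInf_le hbdd ⟨x, hx, 0, T.zero_mem, rfl⟩
      _ ≤ C * ‖y‖ := by simpa using hxC
      _ ≤ max C 0 * 1 := by
          gcongr
          exact le_max_left C 0
      _ = max C 0 := mul_one _

theorem exists_norm_le_of_isClosed {K X Y : Type*} [NontriviallyNormedField K]
    [NormedAddCommGroup X] [NormedSpace K X] [CompleteSpace X]
    [NormedAddCommGroup Y] [NormedSpace K Y] [CompleteSpace Y]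
    (T : Submodule K (X × Y)) (hran : IsClosed (ran (T : Set (X × Y))))
    (hT : IsClosed (T : Set (X × Y))) :
    ∃ C : ℝ, ∀ y ∈ ran (T : Set (X × Y)), ∃ x, (x, y) ∈ T ∧ ‖x‖ ≤ C * ‖y‖ := by
  let R : Submodule K Y := T.map (LinearMap.snd K X Y)
  have hR : (R : Set Y) = ran (T : Set (X × Y)) := by
    ext y
    simp [R, ran]
  have : CompleteSpace T := hT.completeSpace_coe
  have : CompleteSpace R := (show IsClosed (R : Set Y) by rwa [hR]).completeSpace_coe
  let f : T →L[K] R := ((ContinuousLinearMap.snd K X Y).comp T.subtypeL).codRestrict R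
    fun p => ⟨p, p.2, rfl⟩
  have hf : Function.Surjective f := by
    rintro ⟨y, p, hp, rfl⟩
    exact ⟨⟨p, hp⟩, rfl⟩
  obtain ⟨C, -, hC⟩ := f.exists_preimage_norm_le hf
  refine ⟨C, fun y hy => ?_⟩
  rw [← hR] at hy
  obtain ⟨⟨⟨x, y'⟩, hp⟩, hpy, hpC⟩ := hC ⟨y, hy⟩
  obtain rfl : y' = y := congrArg Subtype.val hpy
  exact ⟨x, hp, (norm_fst_le (x, y')).trans hpC⟩

theorem isClosed_of_exists_norm_le {K X Y : Type*} [NontriviallyNormedField K]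
    [NormedAddCommGroup X] [NormedSpace K X] [NormedAddCommGroup Y] [NormedSpace K Y]
    (T : Submodule K (X × Y)) (hran : IsClosed (ran (T : Set (X × Y))))
    (hbdd : ∃ C : ℝ, ∀ y ∈ ran (T : Set (X × Y)), ∃ x, (x, y) ∈ T ∧ ‖x‖ ≤ C * ‖y‖)
    (hnull : IsClosed (nullSp (T : Set (X × Y)))) :
    IsClosed (T : Set (X × Y)) := by
  obtain ⟨C, hC⟩ := hbdd
  refine IsSeqClosed.isClosed fun u p hu hup => ?_
  have hfst : Tendsto (fun n => (u n).1) atTop (𝓝 p.1) := hup.fst_nhds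
  have hsnd : Tendsto (fun n => (u n).2) atTop (𝓝 p.2) := hup.snd_nhds
  obtain ⟨x, hx⟩ : p.2 ∈ ran (T : Set (X × Y)) :=
    hran.mem_of_tendsto hsnd (Eventually.of_forall fun n => ⟨(u n).1, hu n⟩)
  have hsub (n : ℕ) : ((u n).1 - x, (u n).2 - p.2) ∈ T := T.sub_mem (hu n) hx
  choose w hwT hwC using fun n => hC ((u n).2 - p.2) ⟨_, hsub n⟩
  have hw : Tendsto w atTop (𝓝 0) := by
    refine squeeze_zero_norm hwC ?_
    simpa using ((hsnd.sub_const p.2).norm.const_mul C)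
  have hlim : Tendsto (fun n => (u n).1 - x - w n) atTop (𝓝 (p.1 - x)) := by
    simpa using (hfst.sub_const x).sub hw
  have hmem : (p.1 - x, (0 : Y)) ∈ T := by
    refine hnull.mem_of_tendsto hlim (Eventually.of_forall fun n => ?_)
    have h := T.sub_mem (hsub n) (hwT n)
    simpa [nullSp] using h
  have h := T.add_mem hmem hx
  simpa using h

end LinRel

open LinRel

/-- **Open mapping theorem for linear relations.** Let `X` and `Y` be Banach
spaces and `T` a linear relation from `X` to `Y` whose range `R(T)` is closed. Then `T` is
closed if and only if the inverse relation `T⁻¹ = {(y,x) : (x,y) ∈ T}` is bounded and the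
null space `N(T)` is closed. -/
theorem statement17 {K X Y : Type*} [NontriviallyNormedField K]
    [NormedAddCommGroup X] [NormedSpace K X] [CompleteSpace X]
    [NormedAddCommGroup Y] [NormedSpace K Y] [CompleteSpace Y]
    (T : Submodule K (X × Y)) (hran : IsClosed (ran (T : Set (X × Y)))) :
    IsClosed (T : Set (X × Y)) ↔
      IsBdd (Prod.swap ⁻¹' (T : Set (X × Y)) : Set (Y × X)) ∧
        IsClosed (nullSp (T : Set (X × Y))) := by
  rw [isBdd_swap_iff]
  exact ⟨fun hT => ⟨exists_norm_le_of_isClosed T hran hT,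
      hT.preimage (by fun_prop : Continuous fun x : X => (x, (0 : Y)))⟩,
    fun h => isClosed_of_exists_norm_le T hran h.1 h.2⟩
end

section
/- Let X, Y, and Z be Banach spaces, T a linear relation from X to Y, and S a linear relation from X to Z with D(T) ⊆ D(S). If T is closed and S is closable, then S is T-bounded, i.e. there exists a constant c ≥ 0 such that ‖S(x)‖ ≤ c(‖x‖ + ‖T(x)‖) for all x ∈ D(T). -/
open Set Filter Topology

open LinRel

namespace LinRel

theorem normAt_le_norm {K X Y : Type*} [Semiring K] [AddCommMonoid X] [Module K X]
    [SeminormedAddCommGroup Y] [Module K Y] (A : Submodule K (X × Y)) {x : X} {y : Y}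
    (h : (x, y) ∈ A) : normAt (A : Set (X × Y)) x ≤ ‖y‖ := by
  refine csInf_le ⟨0, ?_⟩ ⟨y, h, 0, A.zero_mem, by simp⟩
  rintro _ ⟨u, _, v, _, rfl⟩
  exact norm_nonneg _

theorem le_normAt {K X Y : Type*} [Ring K] [AddCommGroup X] [Module K X]
    [SeminormedAddCommGroup Y] [Module K Y] (A : Submodule K (X × Y)) {x : X} {b : ℝ}
    (hx : x ∈ dom (A : Set (X × Y))) (hb : ∀ y, (x, y) ∈ A → b ≤ ‖y‖) :
    b ≤ normAt (A : Set (X × Y)) x := by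
  obtain ⟨y, hy⟩ := hx
  refine le_csInf ⟨_, y, hy, 0, A.zero_mem, rfl⟩ ?_
  rintro _ ⟨u, hu, v, hv, rfl⟩
  refine hb _ ?_
  simpa using A.sub_mem hu hv

/-- The fibre product `{((x, y), z) : (x, y) ∈ T, (x, z) ∈ S}` of two linear relations. -/
def fibreProd {K X Y Z : Type*} [Semiring K] [AddCommMonoid X] [Module K X]
    [AddCommMonoid Y] [Module K Y] [AddCommMonoid Z] [Module K Z]
    (T : Submodule K (X × Y)) (S : Submodule K (X × Z)) : Submodule K ((X × Y) × Z) :=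
  T.comap (LinearMap.fst K (X × Y) Z) ⊓
    S.comap ((LinearMap.fst K X Y).prodMap LinearMap.id)

theorem mem_fibreProd {K X Y Z : Type*} [Semiring K] [AddCommMonoid X] [Module K X]
    [AddCommMonoid Y] [Module K Y] [AddCommMonoid Z] [Module K Z]
    {T : Submodule K (X × Y)} {S : Submodule K (X × Z)} {w : (X × Y) × Z} :
    w ∈ fibreProd T S ↔ w.1 ∈ T ∧ (w.1.1, w.2) ∈ S :=
  Iff.rfl

theorem isClosed_fibreProd {K X Y Z : Type*} [Semiring K]
    [AddCommMonoid X] [Module K X] [TopologicalSpace X]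
    [AddCommMonoid Y] [Module K Y] [TopologicalSpace Y]
    [AddCommMonoid Z] [Module K Z] [TopologicalSpace Z]
    {T : Submodule K (X × Y)} {S : Submodule K (X × Z)}
    (hdom : dom (T : Set (X × Y)) ⊆ dom (S : Set (X × Z)))
    (hT : IsClosed (T : Set (X × Y))) (hS : IsClosableRel (S : Set (X × Z))) :
    IsClosed (fibreProd T S : Set ((X × Y) × Z)) := by
  have h : (fibreProd T S : Set ((X × Y) × Z)) =
      Prod.fst ⁻¹' (T : Set (X × Y)) ∩
        (fun w : (X × Y) × Z => (w.1.1, w.2)) ⁻¹' closure (S : Set (X × Z)) := by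
    ext w
    refine and_congr_right fun hw => ?_
    exact (Set.ext_iff.1 (hS w.1.1 (hdom ⟨w.1.2, hw⟩)) w.2).symm
  rw [h]
  exact (hT.preimage continuous_fst).inter (isClosed_closure.preimage (by fun_prop))

end LinRel

/-- Let `X`, `Y`, and `Z` be Banach spaces, `T` a linear relation from `X`
to `Y`, and `S` a linear relation from `X` to `Z` with `D(T) ⊆ D(S)`. If `T` is closed and
`S` is closable, then `S` is `T`-bounded, i.e. there exists a constant `c ≥ 0` such that
`‖S(x)‖ ≤ c(‖x‖ + ‖T(x)‖)` for all `x ∈ D(T)`. -/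
theorem statement18 {K X Y Z : Type*} [NontriviallyNormedField K]
    [NormedAddCommGroup X] [NormedSpace K X] [CompleteSpace X]
    [NormedAddCommGroup Y] [NormedSpace K Y] [CompleteSpace Y]
    [NormedAddCommGroup Z] [NormedSpace K Z] [CompleteSpace Z]
    (T : Submodule K (X × Y)) (S : Submodule K (X × Z))
    (hdom : dom (T : Set (X × Y)) ⊆ dom (S : Set (X × Z)))
    (hT : IsClosed (T : Set (X × Y))) (hS : IsClosableRel (S : Set (X × Z))) :
    ∃ c : ℝ, 0 ≤ c ∧ ∀ x ∈ dom (T : Set (X × Y)),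
      normAt (S : Set (X × Z)) x ≤ c * (‖x‖ + normAt (T : Set (X × Y)) x) := by
  have : CompleteSpace T := hT.completeSpace_coe
  have : CompleteSpace (fibreProd T S) := (isClosed_fibreProd hdom hT hS).completeSpace_coe
  let p : fibreProd T S →L[K] T :=
    ((ContinuousLinearMap.fst K (X × Y) Z).comp (fibreProd T S).subtypeL).codRestrict T
      fun w => (mem_fibreProd.1 w.2).1
  have hp : Function.Surjective p := by
    rintro ⟨⟨x, y⟩, hxy⟩
    obtain ⟨z, hz⟩ := hdom ⟨y, hxy⟩
    exact ⟨⟨((x, y), z), hxy, hz⟩, rfl⟩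
  obtain ⟨C, hC, hbound⟩ := p.exists_preimage_norm_le hp
  refine ⟨C, hC.le, fun x hx => ?_⟩
  have key : normAt (S : Set (X × Z)) x / C - ‖x‖ ≤ normAt (T : Set (X × Y)) x := by
    refine le_normAt T hx fun y hy => ?_
    obtain ⟨⟨⟨⟨x', y'⟩, z⟩, hw⟩, hpw, hle⟩ := hbound ⟨(x, y), hy⟩
    obtain ⟨rfl, rfl⟩ : x' = x ∧ y' = y := Prod.mk.inj (congrArg Subtype.val hpw)
    rw [sub_le_iff_le_add', div_le_iff₀' hC]
    calc normAt (S : Set (X × Z)) x' ≤ ‖z‖ := normAt_le_norm S (mem_fibreProd.1 hw).2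
      _ ≤ ‖((x', y'), z)‖ := norm_snd_le ((x', y'), z)
      _ ≤ C * ‖(x', y')‖ := hle
      _ ≤ C * (‖x'‖ + ‖y'‖) := by
        gcongr
        exact max_le_add_of_nonneg (norm_nonneg _) (norm_nonneg _)
  rwa [sub_le_iff_le_add', div_le_iff₀' hC] at key
end
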